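/- Let f ∈ H^{3/2}(ℝ/ℤ) be a closed curve in ℝⁿ whose unit tangent t = f'/‖f'‖ satisfies [t]_{H^{1/2}} < ∞, satisfying the bi-Lipschitz condition and, for each m, the equilateral condition, and assume lim_{ε→0⁺} ε⁻¹·K(f',ε)² = 0. Define, with g_{ij,n} = ‖Δᵢʲf‖‖Δ_{i+1}^{j+1}f‖: I₂₁(i,j) = −½·( A_{ij}(‖Δ_{i+1}^{j+1}f‖ − ‖Δᵢʲf‖) / g_{ij,n} )·( (ΔᵢAⱼ‖Δᵢʲf‖)(ΔⱼAᵢ‖Δᵢʲf‖)/A_{ij}‖Δᵢʲf‖ − (ΔᵢAⱼ‖Δ_{i+1}^{j+1}f‖)(ΔⱼAᵢ‖Δ_{i+1}^{j+1}f‖)/A_{ij}‖Δ_{i+1}^{j+1}f‖ ) and I₂₂(i,j) = −(1/(2g_{ij,n}))·( ΔᵢAⱼ(‖Δ_{i+1}^{j+1}f‖ − ‖Δᵢʲf‖) )·( ΔⱼAᵢ(‖Δ_{i+1}^{j+1}f‖ − ‖Δᵢʲf‖) ). Then lim_{m→∞} Σ_{i≠j (mod m)} I₂₁(i,j) = 0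 and lim_{m→∞} Σ_{i≠j (mod m)} I₂₂(i,j) = 0. -/

import Mathlib

open MeasureTheory Real
open scoped RealInnerProductSpace ENNReal

noncomputable section

/-- The standard distance on `ℝ/ℤ`, expressed through real representatives. -/
def circleDist (a b : ℝ) : ℝ := min (Int.fract (a - b)) (1 - Int.fract (a - b))

/-- The `H^{1/2}`-seminorm `[u]_{H^{1/2}(I×J)}`. -/
def seminormH {n : ℕ} (u : ℝ → EuclideanSpace ℝ (Fin n)) (I J : Set ℝ) : ℝ :=
  Real.sqrt (∫ a in I, ∫ b in J, ‖u a - u b‖ ^ 2 / circleDist a b ^ 2)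

/-- `K(u, ε)`: supremum of the `H^{1/2}`-seminorms of `u` over pairs of
measurable subsets of `ℝ/ℤ` of measure at most `ε`. -/
def Kmod {n : ℕ} (u : ℝ → EuclideanSpace ℝ (Fin n)) (ε : ℝ) : ℝ :=
  sSup { r : ℝ | ∃ I J : Set ℝ, MeasurableSet I ∧ MeasurableSet J ∧
    I ⊆ Set.Ico (0 : ℝ) 1 ∧ J ⊆ Set.Ico (0 : ℝ) 1 ∧
    volume I ≤ ENNReal.ofReal ε ∧ volume J ≤ ENNReal.ofReal ε ∧
    r = seminormH u I J }

/-- Difference operator `Δᵢ` in the first index. -/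
def dOpI (u : ℤ → ℤ → ℝ) (i j : ℤ) : ℝ := u (i + 1) j - u i j

/-- Difference operator `Δⱼ` in the second index. -/
def dOpJ (u : ℤ → ℤ → ℝ) (i j : ℤ) : ℝ := u i (j + 1) - u i j

/-- Arithmetic mean `Aᵢ` in the first index. -/
def aOpI (u : ℤ → ℤ → ℝ) (i j : ℤ) : ℝ := (u i j + u (i + 1) j) / 2

/-- Arithmetic mean `Aⱼ` in the second index. -/
def aOpJ (u : ℤ → ℤ → ℝ) (i j : ℤ) : ℝ := (u i j + u i (j + 1)) / 2

/-- Arithmetic mean `A_{ij}` over the four corners. -/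
def aOpIJ (u : ℤ → ℤ → ℝ) (i j : ℤ) : ℝ :=
  (u i j + u (i + 1) j + u i (j + 1) + u (i + 1) (j + 1)) / 4

/-- The chord `Δᵢʲf = f(θⱼ) − f(θᵢ)`. -/
def chord {n : ℕ} (f : ℝ → EuclideanSpace ℝ (Fin n)) (θ : ℤ → ℝ) (i j : ℤ) :
    EuclideanSpace ℝ (Fin n) := f (θ j) - f (θ i)

/-- The edge `Δᵢf = f(θᵢ₊₁) − f(θᵢ)`. -/
def edge {n : ℕ} (f : ℝ → EuclideanSpace ℝ (Fin n)) (θ : ℤ → ℝ) (i : ℤ) :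
    EuclideanSpace ℝ (Fin n) := f (θ (i + 1)) - f (θ i)

/-- The unit edge vector `Δᵢf/‖Δᵢf‖`. -/
def uedge {n : ℕ} (f : ℝ → EuclideanSpace ℝ (Fin n)) (θ : ℤ → ℝ) (i : ℤ) :
    EuclideanSpace ℝ (Fin n) := ‖edge f θ i‖⁻¹ • edge f θ i

/-- Chord length `‖Δᵢʲf‖` as a doubly indexed quantity. -/
def chn {n : ℕ} (f : ℝ → EuclideanSpace ℝ (Fin n)) (θ : ℤ → ℝ) (i j : ℤ) : ℝ :=
  ‖chord f θ i j‖


/-- Sum of `F i j` over ordered pairs of distinct residues mod `m`,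
represented by indices in `{1, …, m}`. -/
def discSum (m : ℕ) (F : ℤ → ℤ → ℝ) : ℝ :=
  ∑ i ∈ Finset.Icc (1 : ℤ) (m : ℤ), ∑ j ∈ Finset.Icc (1 : ℤ) (m : ℤ),
    if i = j then 0 else F i j

/-- The discrete cross ratio
`g_{ij} = ‖Δᵢʲf‖‖Δ_{i+1}^{j+1}f‖/(‖Δᵢf‖‖Δⱼf‖)`. -/
def crossRatio {n : ℕ} (f : ℝ → EuclideanSpace ℝ (Fin n)) (θ : ℤ → ℝ)
    (i j : ℤ) : ℝ :=
  (chn f θ i j * chn f θ (i + 1) (j + 1)) / (‖edge f θ i‖ * ‖edge f θ j‖)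

/-- The unit tangent vector `t = f'/‖f'‖`. -/
def tang {n : ℕ} (f : ℝ → EuclideanSpace ℝ (Fin n)) (x : ℝ) :
    EuclideanSpace ℝ (Fin n) := ‖deriv f x‖⁻¹ • deriv f x

theorem circleDist_eq_abs_sub_round (a b : ℝ) :
    circleDist a b = |a - b - round (a - b)| :=
  (abs_sub_round_eq_min _).symm

theorem circleDist_nonneg (a b : ℝ) : 0 ≤ circleDist a b := by
  rw [circleDist_eq_abs_sub_round]; positivity

theorem circleDist_le (a b : ℝ) (k : ℤ) : circleDist a b ≤ |a - b - k| := by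
  rw [circleDist_eq_abs_sub_round]; exact round_le _ _

theorem circleDist_le_one (a b : ℝ) : circleDist a b ≤ 1 :=
  (min_le_left _ _).trans (Int.fract_lt_one _).le

theorem circleDist_add_int (a b : ℝ) (k l : ℤ) :
    circleDist (a + k) (b + l) = circleDist a b := by
  have : a + k - (b + l) = a - b + ((k - l : ℤ) : ℝ) := by push_cast; ring
  simp only [circleDist, this, Int.fract_add_intCast]

theorem circleDist_le_add (a b x y : ℝ) :
    circleDist x y ≤ circleDist a b + |x - a| + |y - b| := by
  rw [circleDist_eq_abs_sub_round a b]
  refine (circleDist_le x y (round (a - b))).trans ?_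
  have : x - y - round (a - b) = (a - b - round (a - b)) + (x - a) + -(y - b) := by ring
  rw [this]
  refine (abs_add_le _ _).trans ?_
  rw [abs_neg]
  gcongr
  exact abs_add_le _ _

@[fun_prop]
theorem measurable_circleDist : Measurable fun p : ℝ × ℝ => circleDist p.1 p.2 := by
  unfold circleDist
  fun_prop

/-- The integrand of the squared `H^{1/2}`-seminorm. -/
def hKernel {n : ℕ} (u : ℝ → EuclideanSpace ℝ (Fin n)) (p : ℝ × ℝ) : ℝ :=
  ‖u p.1 - u p.2‖ ^ 2 / circleDist p.1 p.2 ^ 2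

theorem hKernel_nonneg {n : ℕ} (u : ℝ → EuclideanSpace ℝ (Fin n)) (p : ℝ × ℝ) :
    0 ≤ hKernel u p := by
  unfold hKernel; positivity

/-- The part of the squared `H^{1/2}`-seminorm over `[0,2)²` coming from points at distance at
most `η`. -/
def nearEnergy {n : ℕ} (u : ℝ → EuclideanSpace ℝ (Fin n)) (η : ℝ) : ℝ :=
  ∫ p in (Set.Ico (0 : ℝ) 2 ×ˢ Set.Ico (0 : ℝ) 2) ∩ {p | circleDist p.1 p.2 ≤ η}, hKernel u p

theorem nearEnergy_nonneg {n : ℕ} (u : ℝ → EuclideanSpace ℝ (Fin n)) (η : ℝ) :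
    0 ≤ nearEnergy u η :=
  integral_nonneg fun p => hKernel_nonneg u p

theorem measurableSet_circleDist_le (η : ℝ) :
    MeasurableSet {p : ℝ × ℝ | circleDist p.1 p.2 ≤ η} :=
  measurableSet_le measurable_circleDist measurable_const

theorem integrableOn_hKernel_add_int {n : ℕ} {u : ℝ → EuclideanSpace ℝ (Fin n)}
    (hu : Function.Periodic u 1)
    (h : IntegrableOn (hKernel u) (Set.Ico (0 : ℝ) 1 ×ˢ Set.Ico (0 : ℝ) 1)) (k l : ℤ) :
    IntegrableOn (hKernel u) (Set.Ico (k : ℝ) (k + 1) ×ˢ Set.Ico (l : ℝ) (l + 1)) := by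
  have hmp : MeasurePreserving (fun p : ℝ × ℝ => p + ((k : ℝ), (l : ℝ))) volume volume :=
    measurePreserving_add_right volume _
  have hme : MeasurableEmbedding (fun p : ℝ × ℝ => p + ((k : ℝ), (l : ℝ))) :=
    (MeasurableEquiv.addRight _).measurableEmbedding
  rw [← hmp.integrableOn_comp_preimage hme]
  have hk : ∀ (x : ℝ) (k : ℤ), u (x + k) = u x := fun x k => by simpa using hu.int_mul k x
  convert h using 1
  · ext p
    simp [hKernel, hk, circleDist_add_int]
  · ext p
    simp [add_comm (k : ℝ) 1, add_comm (l : ℝ) 1]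

theorem integrableOn_hKernel_Ico_two {n : ℕ} {u : ℝ → EuclideanSpace ℝ (Fin n)}
    (hu : Function.Periodic u 1)
    (h : IntegrableOn (hKernel u) (Set.Ico (0 : ℝ) 1 ×ˢ Set.Ico (0 : ℝ) 1)) :
    IntegrableOn (hKernel u) (Set.Ico (0 : ℝ) 2 ×ˢ Set.Ico (0 : ℝ) 2) := by
  have hI : Set.Ico (0 : ℝ) 2 = Set.Ico (0 : ℝ) (0 + 1) ∪ Set.Ico (1 : ℝ) (1 + 1) := by
    rw [zero_add, Set.Ico_union_Ico_eq_Ico] <;> norm_num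
  have key := integrableOn_hKernel_add_int hu h
  rw [hI, Set.union_prod, Set.prod_union, Set.prod_union]
  refine ((?_ : IntegrableOn _ _ _).union ?_).union ((?_ : IntegrableOn _ _ _).union ?_)
  · simpa using key 0 0
  · simpa using key 0 1
  · simpa using key 1 0
  · simpa using key 1 1

theorem nearEnergy_tendsto_zero {n : ℕ} {u : ℝ → EuclideanSpace ℝ (Fin n)}
    (h : IntegrableOn (hKernel u) (Set.Ico (0 : ℝ) 2 ×ˢ Set.Ico (0 : ℝ) 2)) :
    Filter.Tendsto (nearEnergy u) (nhdsWithin 0 (Set.Ioi 0)) (nhds 0) := by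
  have key : Filter.Tendsto
      (fun η : ℝ => ∫ p in Set.Ico (0 : ℝ) 2 ×ˢ Set.Ico (0 : ℝ) 2,
        {p : ℝ × ℝ | circleDist p.1 p.2 ≤ η}.indicator (hKernel u) p)
      (nhdsWithin 0 (Set.Ioi 0)) (nhds (∫ p in Set.Ico (0 : ℝ) 2 ×ˢ Set.Ico (0 : ℝ) 2, 0)) := by
    refine tendsto_integral_filter_of_dominated_convergence (hKernel u) ?_ ?_ h ?_
    · exact Filter.Eventually.of_forall fun η =>
        h.aestronglyMeasurable.indicator (measurableSet_circleDist_le η)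
    · refine Filter.Eventually.of_forall fun η => Filter.Eventually.of_forall fun p => ?_
      refine (norm_indicator_le_norm_self _ _).trans ?_
      rw [Real.norm_of_nonneg (hKernel_nonneg u p)]
    · refine Filter.Eventually.of_forall fun p => ?_
      refine tendsto_const_nhds.congr' ?_
      rcases (circleDist_nonneg p.1 p.2).eq_or_lt with h0 | h0
      · refine Filter.Eventually.of_forall fun η => ?_
        simp [Set.indicator, hKernel, ← h0]
      · filter_upwards [nhdsWithin_le_nhds (Iio_mem_nhds h0)] with η hη
        rw [Set.indicator_of_notMem]
        simpa using hη
  simp only [integral_zero] at key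
  refine key.congr fun η => ?_
  rw [nearEnergy, setIntegral_indicator (measurableSet_circleDist_le η)]

/-- A vector-valued Poincaré-type estimate: the difference of the means of `u` over two intervals
is controlled by the `H^{1/2}`-energy of the product. -/
theorem sq_norm_smul_sub_smul_integral_le {n : ℕ} {u : ℝ → EuclideanSpace ℝ (Fin n)}
    {a a' b b' D : ℝ} (ha : a < a') (hb : b < b')
    (hua : IntegrableOn u (Set.Ico a a')) (hub : IntegrableOn u (Set.Ico b b'))
    (hker : IntegrableOn (hKernel u) (Set.Ico a a' ×ˢ Set.Ico b b'))
    (hpos : ∀ x ∈ Set.Ico a a', ∀ y ∈ Set.Ico b b', 0 < circleDist x y)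
    (hD : ∀ x ∈ Set.Ico a a', ∀ y ∈ Set.Ico b b', circleDist x y ≤ D) :
    ‖(b' - b) • (∫ t in a..a', u t) - (a' - a) • ∫ t in b..b', u t‖ ^ 2 ≤
      (a' - a) * (b' - b) * D ^ 2 * ∫ p in Set.Ico a a' ×ˢ Set.Ico b b', hKernel u p := by
  set s := Set.Ico a a' ×ˢ Set.Ico b b' with hs
  have hprod : (volume : Measure (ℝ × ℝ)).restrict s =
      (volume.restrict (Set.Ico a a')).prod (volume.restrict (Set.Ico b b')) := by
    rw [Measure.prod_restrict, Measure.volume_eq_prod]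
  have hms : MeasurableSet s := measurableSet_Ico.prod measurableSet_Ico
  have hV : volume.real s = (a' - a) * (b' - b) := by
    rw [Measure.volume_eq_prod, hs, measureReal_prod_prod, Real.volume_real_Ico_of_le ha.le,
      Real.volume_real_Ico_of_le hb.le]
  have hVtop : volume s ≠ ⊤ := by
    rw [Measure.volume_eq_prod, hs, Measure.prod_prod]
    exact ENNReal.mul_ne_top (by simp) (by simp)
  have hi1 : IntegrableOn (fun p : ℝ × ℝ => u p.1) s := by
    rw [IntegrableOn, hprod]; exact hua.comp_fst _
  have hi2 : IntegrableOn (fun p : ℝ × ℝ => u p.2) s := by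
    rw [IntegrableOn, hprod]; exact hub.comp_snd _
  have hG : IntegrableOn (fun p : ℝ × ℝ => u p.1 - u p.2) s := hi1.sub hi2
  have hint : (b' - b) • (∫ t in a..a', u t) - (a' - a) • (∫ t in b..b', u t) =
      ∫ p in s, (u p.1 - u p.2) := by
    rw [integral_sub hi1 hi2, hprod, integral_fun_fst, integral_fun_snd,
      intervalIntegral.integral_of_le ha.le, intervalIntegral.integral_of_le hb.le,
      integral_Ico_eq_integral_Ioc, integral_Ico_eq_integral_Ioc]
    simp [ha.le, hb.le]
  set A := ∫ p in s, ‖u p.1 - u p.2‖ with hA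
  set E := ∫ p in s, hKernel u p with hE
  have hnorm : ‖∫ p in s, (u p.1 - u p.2)‖ ≤ A := norm_integral_le_integral_norm _
  have hVpos : 0 < (a' - a) * (b' - b) := mul_pos (sub_pos.2 ha) (sub_pos.2 hb)
  have hcs : ∀ c : ℝ, 2 * c * A ≤ c ^ 2 * ((a' - a) * (b' - b)) + D ^ 2 * E := by
    intro c
    have h1 : ∫ p in s, 2 * c * ‖u p.1 - u p.2‖ ≤ ∫ p in s, (c ^ 2 + D ^ 2 * hKernel u p) := by
      refine setIntegral_mono_on (hG.norm.const_mul _) ?_ hms ?_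
      · exact (integrableOn_const hVtop).add (hker.const_mul _)
      · rintro p ⟨h1, h2⟩
        have hp := hpos _ h1 _ h2
        have hd := hD _ h1 _ h2
        have : ‖u p.1 - u p.2‖ ^ 2 = circleDist p.1 p.2 ^ 2 * hKernel u p := by
          unfold hKernel; field_simp
        have h3 : circleDist p.1 p.2 ^ 2 * hKernel u p ≤ D ^ 2 * hKernel u p := by
          have := hKernel_nonneg u p
          gcongr
        nlinarith [sq_nonneg (c - ‖u p.1 - u p.2‖)]
    have hc : Integrable (fun _ : ℝ × ℝ => c ^ 2) (volume.restrict s) := integrableOn_const hVtop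
    rw [integral_const_mul, integral_add hc (hker.const_mul _),
      integral_const_mul, setIntegral_const, hV, smul_eq_mul] at h1
    linarith
  have hA2 : A ^ 2 ≤ (a' - a) * (b' - b) * D ^ 2 * E := by
    set V := (a' - a) * (b' - b)
    have := hcs (A / V)
    have h2 : 2 * (A / V) * A = 2 * (A ^ 2 / V) := by ring
    have h3 : (A / V) ^ 2 * V = A ^ 2 / V := by field_simp
    rw [h2, h3] at this
    have h4 : A ^ 2 / V ≤ D ^ 2 * E := by linarith
    rw [div_le_iff₀ hVpos] at h4
    linarith
  rw [hint]
  exact (pow_le_pow_left₀ (norm_nonneg _) hnorm 2).trans hA2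

/-- The quantitative properties of a sequence of parameters inscribing an equilateral polygon with
`m` edges of length `h` in the bi-Lipschitz closed curve `f`. -/
structure IsEquilateralGrid {n : ℕ} (f : ℝ → EuclideanSpace ℝ (Fin n)) (L₁ L₂ h : ℝ) (m : ℕ)
    (θ : ℤ → ℝ) : Prop where
  periodic : Function.Periodic f 1
  L₁_pos : 0 < L₁
  L₂_pos : 0 < L₂
  le_norm : ∀ a b, L₁ * circleDist a b ≤ ‖f a - f b‖
  norm_le : ∀ a b, ‖f a - f b‖ ≤ L₂ * circleDist a b
  strictMono : StrictMono θ
  add_card : ∀ i : ℤ, θ (i + m) = θ i + 1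
  zero_le : 0 ≤ θ 1
  lt_one : θ m < 1
  one_lt_card : 1 < m
  norm_edge : ∀ i, ‖edge f θ i‖ = h
  h_pos : 0 < h
  gap_le : ∀ i, L₁ * (θ (i + 1) - θ i) ≤ h

theorem norm_sub_le_mul_sub {n : ℕ} {f : ℝ → EuclideanSpace ℝ (Fin n)} {L₂ a b : ℝ}
    (hL₂ : 0 < L₂) (hf : ∀ a b, ‖f a - f b‖ ≤ L₂ * circleDist a b) (hab : a ≤ b) :
    ‖f b - f a‖ ≤ L₂ * (b - a) := by
  refine (hf b a).trans ?_
  gcongr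
  simpa [abs_of_nonneg (sub_nonneg.2 hab)] using circleDist_le b a 0

theorem nsmul_edge_le {n : ℕ} {f : ℝ → EuclideanSpace ℝ (Fin n)} {L₂ h : ℝ} {θ : ℤ → ℝ}
    (hL₂ : 0 < L₂) (hf : ∀ a b, ‖f a - f b‖ ≤ L₂ * circleDist a b) (hθ : StrictMono θ)
    (he : ∀ i, ‖edge f θ i‖ = h) (i : ℤ) (k : ℕ) : k * h ≤ L₂ * (θ (i + k) - θ i) := by
  induction k with
  | zero => simp
  | succ k ih =>
    have h1 : ‖edge f θ (i + k)‖ ≤ L₂ * (θ (i + k + 1) - θ (i + k)) :=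
      norm_sub_le_mul_sub hL₂ hf (hθ (lt_add_one _)).le
    rw [he] at h1
    push_cast
    rw [← add_assoc]
    linarith

/-- For sufficiently many vertices, an equilateral polygon inscribed in a bi-Lipschitz closed curve
has parameter gaps comparable to its edge length. -/
theorem isEquilateralGrid_of_lt {n : ℕ} {f : ℝ → EuclideanSpace ℝ (Fin n)} {L₁ L₂ h : ℝ} {m : ℕ}
    {θ : ℤ → ℝ} (hf : Function.Periodic f 1) (hL₁ : 0 < L₁) (hL₂ : 0 < L₂)
    (hle : ∀ a b, L₁ * circleDist a b ≤ ‖f a - f b‖)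
    (hge : ∀ a b, ‖f a - f b‖ ≤ L₂ * circleDist a b)
    (hθ : StrictMono θ) (hper : ∀ i : ℤ, θ (i + m) = θ i + 1) (h0 : 0 ≤ θ 1) (h1 : θ m < 1)
    (he : ∀ i, ‖edge f θ i‖ = h) (hm : 1 + L₂ / L₁ < m) :
    IsEquilateralGrid f L₁ L₂ h m θ := by
  have hm1 : (1 : ℝ) < m := lt_trans (by simp [hL₁, hL₂]) hm
  have hm1' : 1 < m := by exact_mod_cast hm1
  have hgap : ∀ i, 0 < θ (i + 1) - θ i := fun i => sub_pos.2 (hθ (lt_add_one i))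
  have hsum : ∀ i, (m - 1 : ℝ) * h ≤ L₂ * (1 - (θ (i + 1) - θ i)) := by
    intro i
    have := nsmul_edge_le hL₂ hge hθ he (i + 1) (m - 1)
    rw [Nat.cast_sub hm1'.le, Nat.cast_sub hm1'.le] at this
    have h2 : i + 1 + ((m : ℤ) - (1 : ℕ)) = i + m := by push_cast; ring
    rw [h2, hper] at this
    push_cast at this
    linarith
  have hlt : ∀ i, θ (i + 1) - θ i < 1 := by
    intro i
    have h2 : θ (i + 1) < θ (i + m) := hθ (by omega)
    rw [hper] at h2
    linarith
  have hcd : ∀ i, circleDist (θ (i + 1)) (θ i) =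
      min (θ (i + 1) - θ i) (1 - (θ (i + 1) - θ i)) := by
    intro i
    rw [circleDist, Int.fract_eq_self.2 ⟨(hgap i).le, hlt i⟩]
  have hbd : ∀ i, L₁ * min (θ (i + 1) - θ i) (1 - (θ (i + 1) - θ i)) ≤ h := by
    intro i
    rw [← hcd, ← he i]
    exact hle _ _
  have hh : 0 < h := lt_of_lt_of_le
    (mul_pos hL₁ (lt_min (hgap 0) (by have := hlt 0; linarith))) (hbd 0)
  refine ⟨hf, hL₁, hL₂, hle, hge, hθ, hper, h0, h1, hm1', he, hh, fun i => ?_⟩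
  rcases le_total (θ (i + 1) - θ i) (1 - (θ (i + 1) - θ i)) with h2 | h2
  · simpa [min_eq_left h2] using hbd i
  · exfalso
    have h3 := hbd i
    rw [min_eq_right h2] at h3
    have h4 := hsum i
    have h5 : L₂ < (m - 1) * L₁ := by
      rw [← div_lt_iff₀ hL₁]; linarith
    have h6 : L₁ * ((m - 1 : ℝ) * h) ≤ L₂ * h := by
      calc L₁ * ((m - 1 : ℝ) * h) ≤ L₁ * (L₂ * (1 - (θ (i + 1) - θ i))) := by gcongr
        _ = L₂ * (L₁ * (1 - (θ (i + 1) - θ i))) := by ring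
        _ ≤ L₂ * h := by gcongr
    nlinarith

/-- The half-open parameter interval between consecutive vertices. -/
def gridCell (θ : ℤ → ℝ) (i : ℤ) : Set ℝ := Set.Ico (θ i) (θ (i + 1))

/-- The part of the squared `H^{1/2}`-seminorm over a product of two parameter intervals coming
from points at distance at most `η`. -/
def cellEnergy {n : ℕ} (u : ℝ → EuclideanSpace ℝ (Fin n)) (θ : ℤ → ℝ) (η : ℝ) (a b : ℤ) : ℝ :=
  ∫ p in (gridCell θ a ×ˢ gridCell θ b) ∩ {p | circleDist p.1 p.2 ≤ η}, hKernel u p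

theorem cellEnergy_nonneg {n : ℕ} (u : ℝ → EuclideanSpace ℝ (Fin n)) (θ : ℤ → ℝ) (η : ℝ)
    (a b : ℤ) : 0 ≤ cellEnergy u θ η a b :=
  integral_nonneg fun p => hKernel_nonneg u p

theorem disjoint_gridCell {θ : ℤ → ℝ} (hθ : StrictMono θ) {a b : ℤ} (hab : a ≠ b) :
    Disjoint (gridCell θ a) (gridCell θ b) := by
  wlog h : a < b generalizing a b
  · exact (this hab.symm (by omega)).symm
  refine Set.disjoint_left.2 fun x hx hx' => ?_
  have := hθ.monotone (show a + 1 ≤ b by omega)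
  exact absurd (hx.2.trans_le (this.trans hx'.1)) (lt_irrefl _)

theorem norm_smul_sub_le_of_norm_eq {E : Type*} [NormedAddCommGroup E] [NormedSpace ℝ E] {v w : E}
    (hvw : ‖v‖ = ‖w‖) {a b : ℝ} (ha : 0 ≤ a) (hb : 0 ≤ b) :
    a * ‖v - w‖ ≤ 2 * ‖a • v - b • w‖ := by
  have h1 : a • (v - w) = (a • v - b • w) + (b - a) • w := by module
  have h2 : |b - a| * ‖w‖ ≤ ‖a • v - b • w‖ := by
    have := abs_norm_sub_norm_le (b • w) (a • v)
    rw [norm_smul, norm_smul, hvw, ← sub_mul, abs_mul, abs_norm, norm_sub_rev,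
      Real.norm_of_nonneg ha, Real.norm_of_nonneg hb] at this
    exact this
  have h3 := norm_add_le (a • v - b • w) ((b - a) • w)
  rw [← h1, norm_smul, norm_smul, Real.norm_of_nonneg ha, Real.norm_eq_abs] at h3
  linarith

namespace IsEquilateralGrid

variable {n : ℕ} {f fd : ℝ → EuclideanSpace ℝ (Fin n)} {L₁ L₂ h : ℝ} {m : ℕ} {θ : ℤ → ℝ}

theorem add_mul_card (H : IsEquilateralGrid f L₁ L₂ h m θ) (i k : ℤ) :
    θ (i + k * m) = θ i + k := by
  induction k using Int.induction_on with
  | zero => simp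
  | succ k ih =>
    have : i + ((k : ℤ) + 1) * m = i + k * m + m := by ring
    rw [this, H.add_card, ih]; push_cast; ring
  | pred k ih =>
    have h1 := H.add_card (i + (-(k : ℤ) - 1) * m)
    have : i + (-(k : ℤ) - 1) * m + m = i + -(k : ℤ) * m := by ring
    rw [this, ih] at h1
    push_cast at h1 ⊢
    linarith

theorem edge_add_mul_card (H : IsEquilateralGrid f L₁ L₂ h m θ) (i k : ℤ) :
    edge f θ (i + k * m) = edge f θ i := by
  have hk : ∀ x : ℝ, f (x + k) = f x := fun x => by simpa using H.periodic.int_mul k x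
  have : i + k * m + 1 = i + 1 + k * m := by ring
  simp only [edge, this, H.add_mul_card, hk]

theorem le_mul_gap (H : IsEquilateralGrid f L₁ L₂ h m θ) (i : ℤ) :
    h ≤ L₂ * (θ (i + 1) - θ i) := by
  simpa using nsmul_edge_le H.L₂_pos H.norm_le H.strictMono H.norm_edge i 1

theorem card_mul_le (H : IsEquilateralGrid f L₁ L₂ h m θ) : m * h ≤ L₂ := by
  have := nsmul_edge_le H.L₂_pos H.norm_le H.strictMono H.norm_edge 0 m
  rw [H.add_card] at this
  linarith

theorem gap_pos (H : IsEquilateralGrid f L₁ L₂ h m θ) (i : ℤ) : 0 < θ (i + 1) - θ i :=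
  sub_pos.2 (H.strictMono (lt_add_one i))

theorem mul_le_chn (H : IsEquilateralGrid f L₁ L₂ h m θ) {a b : ℤ} (hab : ¬ (m : ℤ) ∣ b - a) :
    L₁ * h ≤ L₂ * chn f θ a b := by
  set k := round (θ b - θ a)
  have hk : circleDist (θ b) (θ a) = |θ b - θ (a + k * m)| := by
    rw [circleDist_eq_abs_sub_round, H.add_mul_card, sub_sub]
  have hne : b ≠ a + k * m := fun h => hab ⟨k, by rw [h]; ring⟩
  have h1 : h ≤ L₂ * |θ b - θ (a + k * m)| := by
    rcases lt_or_gt_of_ne hne with h2 | h2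
    · have h3 := H.strictMono.monotone (show b + 1 ≤ a + k * m by omega)
      refine (H.le_mul_gap b).trans ?_
      have := H.L₂_pos
      rw [abs_sub_comm]
      gcongr
      exact (sub_le_sub_right h3 _).trans (le_abs_self _)
    · have h3 := H.strictMono.monotone (show a + k * m + 1 ≤ b by omega)
      refine (H.le_mul_gap (a + k * m)).trans ?_
      have := H.L₂_pos
      gcongr
      exact (sub_le_sub_right h3 _).trans (le_abs_self _)
  rw [← hk] at h1
  have h2 : L₁ * circleDist (θ b) (θ a) ≤ chn f θ a b := H.le_norm _ _
  have := H.L₁_pos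
  have := H.L₂_pos
  calc L₁ * h ≤ L₁ * (L₂ * circleDist (θ b) (θ a)) := by gcongr
    _ = L₂ * (L₁ * circleDist (θ b) (θ a)) := by ring
    _ ≤ _ := by gcongr

theorem mul_circleDist_le (H : IsEquilateralGrid f L₁ L₂ h m θ) {a b : ℤ} {x y : ℝ}
    (hx : x ∈ gridCell θ a) (hy : y ∈ gridCell θ b) :
    L₁ * circleDist x y ≤ chn f θ a b + 2 * h := by
  have h1 := circleDist_le_add (θ a) (θ b) x y
  have h2 : L₁ * circleDist (θ a) (θ b) ≤ chn f θ a b := by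
    rw [chn, chord, norm_sub_rev]; exact H.le_norm _ _
  have hxa : |x - θ a| ≤ θ (a + 1) - θ a := by
    rw [abs_of_nonneg (sub_nonneg.2 hx.1)]; linarith [hx.2]
  have hyb : |y - θ b| ≤ θ (b + 1) - θ b := by
    rw [abs_of_nonneg (sub_nonneg.2 hy.1)]; linarith [hy.2]
  have := H.gap_le a
  have := H.gap_le b
  have := H.L₁_pos
  calc L₁ * circleDist x y
      ≤ L₁ * (circleDist (θ a) (θ b) + (θ (a + 1) - θ a) + (θ (b + 1) - θ b)) := by
        gcongr; linarith
    _ ≤ _ := by linarith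

theorem circleDist_pos (H : IsEquilateralGrid f L₁ L₂ h m θ) {a b : ℤ}
    (hab : ¬ (m : ℤ) ∣ b - a) {x y : ℝ} (hx : x ∈ gridCell θ a) (hy : y ∈ gridCell θ b) :
    0 < circleDist x y := by
  refine (circleDist_nonneg x y).lt_of_ne fun h0 => ?_
  rw [circleDist_eq_abs_sub_round, eq_comm, abs_eq_zero, sub_eq_zero] at h0
  set k := round (x - y)
  have hyk : x ∈ gridCell θ (b + k * m) := by
    have h1 : b + k * m + 1 = b + 1 + k * m := by ring
    have h2 : x = y + k := by rw [← h0]; ring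
    rw [gridCell, h1, H.add_mul_card, H.add_mul_card, h2]
    exact ⟨by linarith [hy.1], by linarith [hy.2]⟩
  have hne : a ≠ b + k * m := fun h => hab ⟨-k, by rw [h]; ring⟩
  exact Set.disjoint_left.1 (disjoint_gridCell H.strictMono hne) hx hyk

theorem gridCell_subset (H : IsEquilateralGrid f L₁ L₂ h m θ) {a : ℤ}
    (ha : a ∈ Set.Icc (1 : ℤ) (m + 1)) : gridCell θ a ⊆ Set.Ico 0 2 := by
  have hm := H.one_lt_card
  have h1 := H.strictMono.monotone ha.1
  have h2 : θ (a + 1) ≤ θ (m + m) := by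
    refine H.strictMono.monotone ?_
    have := ha.2
    omega
  rw [H.add_card] at h2
  have := H.lt_one
  have := H.zero_le
  exact Set.Ico_subset_Ico (by linarith) (by linarith)

theorem sq_norm_edge_sub_edge_le (H : IsEquilateralGrid f L₁ L₂ h m θ)
    (hfd : LocallyIntegrable fd volume) (hFTC : ∀ a b : ℝ, f b - f a = ∫ t in a..b, fd t)
    (hker : IntegrableOn (hKernel fd) (Set.Ico (0 : ℝ) 2 ×ˢ Set.Ico (0 : ℝ) 2)) {a b : ℤ}
    (ha : a ∈ Set.Icc (1 : ℤ) (m + 1)) (hb : b ∈ Set.Icc (1 : ℤ) (m + 1)) {D η : ℝ}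
    (hD : (chn f θ a b + 2 * h) / L₁ ≤ D)
    (hη : ∀ x ∈ gridCell θ a, ∀ y ∈ gridCell θ b, circleDist x y ≤ η) :
    ‖edge f θ b - edge f θ a‖ ^ 2 ≤ 4 * (L₂ / L₁) * D ^ 2 * cellEnergy fd θ η a b := by
  have hL₁ := H.L₁_pos
  have hL₂ := H.L₂_pos
  have hE := cellEnergy_nonneg fd θ η a b
  by_cases hab : (m : ℤ) ∣ b - a
  · obtain ⟨k, hk⟩ := hab
    have : b = a + k * m := by linarith
    rw [this, H.edge_add_mul_card, ← this]
    rw [sub_self, norm_zero, zero_pow two_ne_zero]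
    positivity
  have hga := H.gap_pos a
  have hgb := H.gap_pos b
  have hloc : ∀ i, IntegrableOn fd (gridCell θ i) := fun i =>
    (hfd.integrableOn_isCompact isCompact_Icc).mono_set Set.Ico_subset_Icc_self
  have hcell : cellEnergy fd θ η a b = ∫ p in gridCell θ a ×ˢ gridCell θ b, hKernel fd p := by
    rw [cellEnergy, Set.inter_eq_left.2]
    exact fun p hp => hη _ hp.1 _ hp.2
  have key := sq_norm_smul_sub_smul_integral_le (D := D) (sub_pos.1 hga) (sub_pos.1 hgb) (hloc a)
    (hloc b) (hker.mono_set (Set.prod_mono (H.gridCell_subset ha) (H.gridCell_subset hb)))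
    (fun x hx y hy => H.circleDist_pos hab hx hy) (fun x hx y hy => by
      refine le_trans ?_ hD
      rw [le_div_iff₀' hL₁]
      exact H.mul_circleDist_le hx hy)
  rw [← hFTC, ← hFTC] at key
  change ‖_ • edge f θ a - _ • edge f θ b‖ ^ 2 ≤ _ * ∫ p in gridCell θ a ×ˢ gridCell θ b, _ at key
  rw [← hcell] at key
  have h1 := norm_smul_sub_le_of_norm_eq
    ((H.norm_edge a).trans (H.norm_edge b).symm) hgb.le hga.le
  have h2 : (θ (b + 1) - θ b) ^ 2 * ‖edge f θ a - edge f θ b‖ ^ 2 ≤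
      4 * ((θ (a + 1) - θ a) * (θ (b + 1) - θ b) * D ^ 2 * cellEnergy fd θ η a b) := by
    have := pow_le_pow_left₀ (by positivity) h1 2
    rw [mul_pow, mul_pow] at this
    linarith
  have h3 : L₁ * (θ (a + 1) - θ a) ≤ L₂ * (θ (b + 1) - θ b) :=
    (H.gap_le a).trans (H.le_mul_gap b)
  rw [norm_sub_rev]
  have h4 : (θ (b + 1) - θ b) * ‖edge f θ a - edge f θ b‖ ^ 2 ≤
      4 * (θ (a + 1) - θ a) * D ^ 2 * cellEnergy fd θ η a b := by
    refine le_of_mul_le_mul_left ?_ hgb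
    linarith
  have h5 : θ (a + 1) - θ a ≤ L₂ / L₁ * (θ (b + 1) - θ b) := by
    rw [div_mul_eq_mul_div, le_div_iff₀' hL₁]; exact h3
  refine le_of_mul_le_mul_left ?_ hgb
  calc _ ≤ _ := h4
    _ ≤ 4 * (L₂ / L₁ * (θ (b + 1) - θ b)) * D ^ 2 * cellEnergy fd θ η a b := by gcongr
    _ = _ := by ring

theorem sum_cellEnergy_le (H : IsEquilateralGrid f L₁ L₂ h m θ)
    (hker : IntegrableOn (hKernel fd) (Set.Ico (0 : ℝ) 2 ×ˢ Set.Ico (0 : ℝ) 2)) (η : ℝ)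
    {ι : Type*} (s : Finset ι) (φ : ι → ℤ × ℤ) (hφ : Set.InjOn φ s)
    (hs : ∀ i ∈ s, φ i ∈ Set.Icc (1 : ℤ) (m + 1) ×ˢ Set.Icc (1 : ℤ) (m + 1)) :
    ∑ i ∈ s, cellEnergy fd θ η (φ i).1 (φ i).2 ≤ nearEnergy fd η := by
  have hsub : ∀ i ∈ s, gridCell θ (φ i).1 ×ˢ gridCell θ (φ i).2 ⊆ Set.Ico 0 2 ×ˢ Set.Ico 0 2 :=
    fun i hi => Set.prod_mono (H.gridCell_subset (hs i hi).1) (H.gridCell_subset (hs i hi).2)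
  unfold cellEnergy nearEnergy
  rw [← integral_biUnion_finset]
  · refine setIntegral_mono_set (hker.mono_set Set.inter_subset_left)
      (Filter.Eventually.of_forall fun p => hKernel_nonneg fd p)
      (LE.le.eventuallyLE ?_)
    exact Set.iUnion₂_subset fun i hi => Set.inter_subset_inter_left _ (hsub i hi)
  · exact fun i _ =>
      (measurableSet_Ico.prod measurableSet_Ico).inter (measurableSet_circleDist_le η)
  · intro i hi j hj hij
    refine Set.disjoint_of_subset Set.inter_subset_left Set.inter_subset_left ?_
    rw [Set.disjoint_prod]
    by_contra! hcon
    refine hij (hφ hi hj (Prod.ext ?_ ?_))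
    · exact by_contra fun h => hcon.1 (disjoint_gridCell H.strictMono h)
    · exact by_contra fun h => hcon.2 (disjoint_gridCell H.strictMono h)
  · exact fun i hi => hker.mono_set (Set.inter_subset_left.trans (hsub i hi))

end IsEquilateralGrid

/-- The increment of the norm under a translation depends in a Lipschitz way on the translation,
and on the base point `c'` with a constant that decays like the inverse of `‖c'‖`. -/
theorem abs_norm_add_sub_norm_sub_le {E : Type*} [NormedAddCommGroup E] [InnerProductSpace ℝ E]
    (c c' w w' : E) (hc' : 0 < ‖c'‖) :
    |(‖c' + w'‖ - ‖c'‖) - (‖c + w‖ - ‖c‖)| ≤ ‖w' - w‖ + 4 * ‖c' - c‖ * ‖w‖ / ‖c'‖ := by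
  have h1 : |‖c' + w'‖ - ‖c' + w‖| ≤ ‖w' - w‖ := by
    simpa using abs_norm_sub_norm_le (c' + w') (c' + w)
  have hG : ∀ x : E, (‖x + w‖ - ‖x‖) * (‖x + w‖ + ‖x‖) = 2 * ⟪x, w⟫ + ‖w‖ ^ 2 := by
    intro x
    have := norm_add_sq_real x w
    linarith
  set G' := ‖c' + w‖ - ‖c'‖ with hG'
  set G := ‖c + w‖ - ‖c‖ with hGd
  have hGw : |G| ≤ ‖w‖ := by simpa [hGd] using abs_norm_sub_norm_le (c + w) c
  have hN : |(‖c + w‖ + ‖c‖) - (‖c' + w‖ + ‖c'‖)| ≤ 2 * ‖c' - c‖ := by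
    have h2 : |‖c + w‖ - ‖c' + w‖| ≤ ‖c' - c‖ := by
      rw [abs_sub_comm]; simpa using abs_norm_sub_norm_le (c' + w) (c + w)
    have h3 : |‖c‖ - ‖c'‖| ≤ ‖c' - c‖ := by
      rw [abs_sub_comm]; exact abs_norm_sub_norm_le c' c
    calc _ = |(‖c + w‖ - ‖c' + w‖) + (‖c‖ - ‖c'‖)| := by congr 1; ring
      _ ≤ _ := (abs_add_le _ _).trans (by linarith)
  have hin : |⟪c' - c, w⟫| ≤ ‖c' - c‖ * ‖w‖ := abs_real_inner_le_norm _ _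
  have h4 : (G' - G) * (‖c' + w‖ + ‖c'‖) =
      2 * ⟪c' - c, w⟫ + G * ((‖c + w‖ + ‖c‖) - (‖c' + w‖ + ‖c'‖)) := by
    rw [inner_sub_left]
    linear_combination hG c' - hG c
  have h5 : |G' - G| * ‖c'‖ ≤ 4 * ‖c' - c‖ * ‖w‖ := by
    calc |G' - G| * ‖c'‖ ≤ |G' - G| * |‖c' + w‖ + ‖c'‖| := by
          gcongr
          rw [abs_of_nonneg (by positivity)]
          linarith [norm_nonneg (c' + w)]
      _ = |2 * ⟪c' - c, w⟫ + G * ((‖c + w‖ + ‖c‖) - (‖c' + w‖ + ‖c'‖))| := by rw [← abs_mul, h4]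
      _ ≤ 2 * |⟪c' - c, w⟫| + |G| * |(‖c + w‖ + ‖c‖) - (‖c' + w‖ + ‖c'‖)| := by
          refine (abs_add_le _ _).trans ?_
          rw [abs_mul, abs_mul, abs_two]
      _ ≤ 2 * (‖c' - c‖ * ‖w‖) + ‖w‖ * (2 * ‖c' - c‖) := by gcongr
      _ = _ := by ring
  have h6 : |G' - G| ≤ 4 * ‖c' - c‖ * ‖w‖ / ‖c'‖ := (le_div_iff₀ hc').2 h5
  calc _ = |(‖c' + w'‖ - ‖c' + w‖) + (G' - G)| := by congr 1; rw [hG']; ring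
    _ ≤ _ := (abs_add_le _ _).trans (add_le_add h1 h6)

theorem abs_mul_div_sub_mul_div_le {α p q p' q' A U V h s k κ : ℝ} (hU : 0 < U) (hV : 0 < V)
    (hs : 0 ≤ s) (hh : 0 ≤ h) (hk : 0 ≤ k) (hUV : U ≤ k * V) (hhU : h ≤ κ * U)
    (hα : |α| ≤ s) (hpp : |p' - p| ≤ 2 * s) (hqq : |q' - q| ≤ 2 * s) (hp : |p| ≤ h) (hq : |q| ≤ h)
    (hp' : |p'| ≤ h) (hA : U / 4 ≤ A) (hB : V / 4 ≤ A + α) :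
    |p * q / A - p' * q' / (A + α)| ≤ 16 * k * (1 + κ) * (s * h / U) := by
  have hA0 : 0 < A := by linarith
  have hB0 : 0 < A + α := by linarith
  have hUB : U ≤ 4 * k * (A + α) := by nlinarith
  have hsplit : p * q / A - p' * q' / (A + α) =
      (-((p' - p) * q) - p' * (q' - q)) / (A + α) + p * q * α / (A * (A + α)) := by
    field_simp
    ring
  have hX : |(-((p' - p) * q) - p' * (q' - q)) / (A + α)| ≤ 16 * k * (s * h / U) := by
    rw [abs_div, abs_of_pos hB0]
    have hnum : |-((p' - p) * q) - p' * (q' - q)| ≤ 4 * (s * h) := by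
      calc _ ≤ |p' - p| * |q| + |p'| * |q' - q| := by
            refine (abs_sub _ _).trans ?_
            rw [abs_neg, abs_mul, abs_mul]
        _ ≤ 2 * s * h + h * (2 * s) := by gcongr
        _ = _ := by ring
    calc _ ≤ 4 * (s * h) / (A + α) := by gcongr
      _ ≤ 16 * k * (s * h / U) := by
        rw [← mul_div_assoc, div_le_div_iff₀ hB0 hU]
        have := mul_le_mul_of_nonneg_left hUB (mul_nonneg hs hh)
        linarith
  have hY : |p * q * α / (A * (A + α))| ≤ 16 * k * κ * (s * h / U) := by
    have hAB : 0 < A * (A + α) := mul_pos hA0 hB0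
    rw [abs_div, abs_of_pos hAB, abs_mul, abs_mul]
    calc _ ≤ h * h * s / (A * (A + α)) := by gcongr
      _ ≤ 16 * k * κ * (s * h / U) := by
        rw [← mul_div_assoc, div_le_div_iff₀ hAB hU]
        have h1 : U * U ≤ 16 * k * (A * (A + α)) := by
          calc U * U ≤ (4 * A) * (4 * k * (A + α)) := by
                gcongr; linarith
            _ = _ := by ring
        have hκ : 0 ≤ κ * U := hh.trans hhU
        have hκ' : 0 ≤ κ := nonneg_of_mul_nonneg_left hκ hU
        calc h * h * s * U ≤ h * (κ * U) * s * U := by gcongr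
          _ = (h * s * κ) * (U * U) := by ring
          _ ≤ (h * s * κ) * (16 * k * (A * (A + α))) := by gcongr
          _ = _ := by ring
  rw [hsplit]
  refine (abs_add_le _ _).trans ((add_le_add hX hY).trans_eq ?_)
  ring

section ShiftDifference

/-- The shift-difference `u_{(i+1)(j+1)} - u_{ij}`. -/
def shiftDiff (u : ℤ → ℤ → ℝ) (i j : ℤ) : ℝ := u (i + 1) (j + 1) - u i j

/-- The term `I₂₁` of a doubly indexed quantity. -/
def quotientTerm (u : ℤ → ℤ → ℝ) (i j : ℤ) : ℝ :=
  -(1 / 2) * (aOpIJ (shiftDiff u) i j / (u i j * u (i + 1) (j + 1))) *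
    ((dOpI (aOpJ u) i j * dOpJ (aOpI u) i j) / aOpIJ u i j -
      (dOpI (aOpJ (fun a b => u (a + 1) (b + 1))) i j *
        dOpJ (aOpI (fun a b => u (a + 1) (b + 1))) i j) /
          aOpIJ (fun a b => u (a + 1) (b + 1)) i j)

/-- The term `I₂₂` of a doubly indexed quantity. -/
def productTerm (u : ℤ → ℤ → ℝ) (i j : ℤ) : ℝ :=
  -(1 / (2 * (u i j * u (i + 1) (j + 1)))) * dOpI (aOpJ (shiftDiff u)) i j *
    dOpJ (aOpI (shiftDiff u)) i j

variable {u : ℤ → ℤ → ℝ} {h s k κ : ℝ} {i j : ℤ}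

theorem abs_half_add_le {x y c : ℝ} (hx : |x| ≤ c) (hy : |y| ≤ c) : |(x + y) / 2| ≤ c := by
  rw [abs_le] at *
  constructor <;> linarith [hx.1, hx.2, hy.1, hy.2]

theorem abs_dOpI_aOpJ_le {i j : ℤ} (h1 : |u (i + 1) j - u i j| ≤ h)
    (h2 : |u (i + 1) (j + 1) - u i (j + 1)| ≤ h) : |dOpI (aOpJ u) i j| ≤ h := by
  refine le_trans (le_of_eq ?_) (abs_half_add_le h1 h2)
  simp only [dOpI, aOpJ]; congr 1; ring

theorem abs_dOpJ_aOpI_le {i j : ℤ} (h1 : |u i (j + 1) - u i j| ≤ h)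
    (h2 : |u (i + 1) (j + 1) - u (i + 1) j| ≤ h) : |dOpJ (aOpI u) i j| ≤ h := by
  refine le_trans (le_of_eq ?_) (abs_half_add_le h1 h2)
  simp only [dOpJ, aOpI]; congr 1; ring

theorem abs_sub_le_two_mul {x y c : ℝ} (hx : |x| ≤ c) (hy : |y| ≤ c) : |x - y| ≤ 2 * c :=
  (abs_sub _ _).trans (by linarith)

theorem abs_quotientTerm_le (hu : ∀ a b, 0 ≤ u a b) (hI : ∀ a b, |u (a + 1) b - u a b| ≤ h)
    (hJ : ∀ a b, |u a (b + 1) - u a b| ≤ h) (hU : 0 < u i j) (hV : 0 < u (i + 1) (j + 1))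
    (hk : 0 ≤ k) (hUV : u i j ≤ k * u (i + 1) (j + 1)) (hhU : h ≤ κ * u i j)
    (h00 : |shiftDiff u i j| ≤ s) (h10 : |shiftDiff u (i + 1) j| ≤ s)
    (h01 : |shiftDiff u i (j + 1)| ≤ s) (h11 : |shiftDiff u (i + 1) (j + 1)| ≤ s) :
    |quotientTerm u i j| ≤ 8 * k ^ 2 * (1 + κ) * (s ^ 2 / u i j ^ 2) * (h / u i j) := by
  have hs : 0 ≤ s := (abs_nonneg _).trans h00
  have hh : 0 ≤ h := (abs_nonneg _).trans (hI i j)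
  have hα : |aOpIJ (shiftDiff u) i j| ≤ s := by
    rw [abs_le] at *
    constructor <;> simp only [aOpIJ] <;> linarith [h00.1, h00.2, h10.1, h10.2, h01.1, h01.2,
      h11.1, h11.2]
  have hB : aOpIJ (fun a b => u (a + 1) (b + 1)) i j = aOpIJ u i j + aOpIJ (shiftDiff u) i j := by
    simp only [aOpIJ, shiftDiff]; ring
  have hp : dOpI (aOpJ (fun a b => u (a + 1) (b + 1))) i j - dOpI (aOpJ u) i j =
      dOpI (aOpJ (shiftDiff u)) i j := by
    simp only [dOpI, aOpJ, shiftDiff]; ring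
  have hq : dOpJ (aOpI (fun a b => u (a + 1) (b + 1))) i j - dOpJ (aOpI u) i j =
      dOpJ (aOpI (shiftDiff u)) i j := by
    simp only [dOpJ, aOpI, shiftDiff]; ring
  have key := abs_mul_div_sub_mul_div_le (α := aOpIJ (shiftDiff u) i j)
    (p := dOpI (aOpJ u) i j) (q := dOpJ (aOpI u) i j)
    (p' := dOpI (aOpJ (fun a b => u (a + 1) (b + 1))) i j)
    (q' := dOpJ (aOpI (fun a b => u (a + 1) (b + 1))) i j) (A := aOpIJ u i j)
    hU hV hs hh hk hUV hhU hα
    (by rw [hp]; exact abs_dOpI_aOpJ_le (abs_sub_le_two_mul h10 h00) (abs_sub_le_two_mul h11 h01))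
    (by rw [hq]; exact abs_dOpJ_aOpI_le (abs_sub_le_two_mul h01 h00) (abs_sub_le_two_mul h11 h10))
    (abs_dOpI_aOpJ_le (hI _ _) (hI _ _)) (abs_dOpJ_aOpI_le (hJ _ _) (hJ _ _))
    (abs_dOpI_aOpJ_le (hI _ _) (hI _ _))
    (by simp only [aOpIJ]; linarith [hu (i + 1) j, hu i (j + 1), hu (i + 1) (j + 1)])
    (by rw [← hB]; simp only [aOpIJ]
        linarith [hu (i + 1 + 1) (j + 1), hu (i + 1) (j + 1 + 1), hu (i + 1 + 1) (j + 1 + 1)])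
  rw [quotientTerm, hB, abs_mul, abs_mul, abs_div, abs_of_pos (mul_pos hU hV)]
  have h1 : |aOpIJ (shiftDiff u) i j| / (u i j * u (i + 1) (j + 1)) ≤ k * (s / u i j ^ 2) := by
    rw [← mul_div_assoc, div_le_div_iff₀ (mul_pos hU hV) (by positivity)]
    calc _ ≤ s * u i j ^ 2 := by gcongr
      _ = s * u i j * u i j := by ring
      _ ≤ s * u i j * (k * u (i + 1) (j + 1)) := by gcongr
      _ = _ := by ring
  have h2 : |(-(1 / 2) : ℝ)| = 1 / 2 := by norm_num
  rw [h2]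
  calc _ ≤ 1 / 2 * (k * (s / u i j ^ 2)) * (16 * k * (1 + κ) * (s * h / u i j)) := by gcongr
    _ = _ := by ring

theorem abs_productTerm_le {β γ : ℝ} (hU : 0 < u i j) (hV : 0 < u (i + 1) (j + 1))
    (hUV : u i j ≤ k * u (i + 1) (j + 1)) (hβ : |dOpI (aOpJ (shiftDiff u)) i j| ≤ β)
    (hγ : |dOpJ (aOpI (shiftDiff u)) i j| ≤ γ) :
    |productTerm u i j| ≤ k / 2 * (β * γ / u i j ^ 2) := by
  have hβ0 : 0 ≤ β := (abs_nonneg _).trans hβ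
  have hγ0 : 0 ≤ γ := (abs_nonneg _).trans hγ
  have h1 : |-(1 / (2 * (u i j * u (i + 1) (j + 1))))| ≤ k / 2 * (1 / u i j ^ 2) := by
    rw [abs_neg, abs_of_pos (by positivity), div_mul_div_comm, div_le_div_iff₀ (by positivity)
      (by positivity)]
    nlinarith
  rw [productTerm, abs_mul, abs_mul]
  calc _ ≤ k / 2 * (1 / u i j ^ 2) * β * γ := by
        have := (abs_nonneg _).trans h1
        gcongr
    _ = _ := by ring

end ShiftDifference

section Polygon

variable {n : ℕ} (f u : ℝ → EuclideanSpace ℝ (Fin n)) (θ : ℤ → ℝ)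

/-- The total deviation between the edges at `i, i + 1` and those at `j, j + 1`. -/
def edgeDeviation (i j : ℤ) : ℝ :=
  ‖edge f θ j - edge f θ i‖ + ‖edge f θ j - edge f θ (i + 1)‖ +
    ‖edge f θ (j + 1) - edge f θ i‖ + ‖edge f θ (j + 1) - edge f θ (i + 1)‖

/-- The energy of the four parameter cells spanned by `i, i + 1` and `j, j + 1`. -/
def blockEnergy (η : ℝ) (i j : ℤ) : ℝ :=
  cellEnergy u θ η i j + cellEnergy u θ η (i + 1) j +
    cellEnergy u θ η i (j + 1) + cellEnergy u θ η (i + 1) (j + 1)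

theorem blockEnergy_nonneg (η : ℝ) (i j : ℤ) : 0 ≤ blockEnergy u θ η i j := by
  have := cellEnergy_nonneg u θ η
  unfold blockEnergy
  linarith [this i j, this (i + 1) j, this i (j + 1), this (i + 1) (j + 1)]

theorem chn_succ_left_sub (a b : ℤ) : |chn f θ (a + 1) b - chn f θ a b| ≤ ‖edge f θ a‖ := by
  have h : chord f θ (a + 1) b - chord f θ a b = -edge f θ a := by
    simp only [chord, edge]; abel
  have := abs_norm_sub_norm_le (chord f θ (a + 1) b) (chord f θ a b)
  rwa [h, norm_neg] at this

theorem chn_succ_right_sub (a b : ℤ) : |chn f θ a (b + 1) - chn f θ a b| ≤ ‖edge f θ b‖ := by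
  have h : chord f θ a (b + 1) - chord f θ a b = edge f θ b := by
    simp only [chord, edge]; abel
  have := abs_norm_sub_norm_le (chord f θ a (b + 1)) (chord f θ a b)
  rwa [h] at this

theorem shiftDiff_chn (a b : ℤ) : shiftDiff (chn f θ) a b =
    ‖chord f θ a b + (edge f θ b - edge f θ a)‖ - ‖chord f θ a b‖ := by
  simp only [shiftDiff, chn]
  congr 2
  simp only [chord, edge]; abel

theorem abs_shiftDiff_chn_le (a b : ℤ) :
    |shiftDiff (chn f θ) a b| ≤ ‖edge f θ b - edge f θ a‖ := by
  rw [shiftDiff_chn]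
  simpa using abs_norm_sub_norm_le (chord f θ a b + (edge f θ b - edge f θ a)) (chord f θ a b)

theorem abs_shiftDiff_succ_left_sub_le {a b : ℤ} (h : 0 < chn f θ (a + 1) b) :
    |shiftDiff (chn f θ) (a + 1) b - shiftDiff (chn f θ) a b| ≤
      ‖edge f θ (a + 1) - edge f θ a‖ +
        4 * ‖edge f θ a‖ * ‖edge f θ b - edge f θ a‖ / chn f θ (a + 1) b := by
  rw [shiftDiff_chn, shiftDiff_chn]
  have h1 : chord f θ (a + 1) b - chord f θ a b = -edge f θ a := by
    simp only [chord, edge]; abel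
  have h2 : edge f θ b - edge f θ (a + 1) - (edge f θ b - edge f θ a) =
      -(edge f θ (a + 1) - edge f θ a) := by abel
  have := abs_norm_add_sub_norm_sub_le (chord f θ a b) (chord f θ (a + 1) b)
    (edge f θ b - edge f θ a) (edge f θ b - edge f θ (a + 1)) h
  rwa [h1, h2, norm_neg, norm_neg] at this

theorem abs_shiftDiff_succ_right_sub_le {a b : ℤ} (h : 0 < chn f θ a (b + 1)) :
    |shiftDiff (chn f θ) a (b + 1) - shiftDiff (chn f θ) a b| ≤
      ‖edge f θ (b + 1) - edge f θ b‖ +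
        4 * ‖edge f θ b‖ * ‖edge f θ b - edge f θ a‖ / chn f θ a (b + 1) := by
  rw [shiftDiff_chn, shiftDiff_chn]
  have h1 : chord f θ a (b + 1) - chord f θ a b = edge f θ b := by
    simp only [chord, edge]; abel
  have h2 : edge f θ (b + 1) - edge f θ a - (edge f θ b - edge f θ a) =
      edge f θ (b + 1) - edge f θ b := by abel
  have := abs_norm_add_sub_norm_sub_le (chord f θ a b) (chord f θ a (b + 1))
    (edge f θ b - edge f θ a) (edge f θ (b + 1) - edge f θ a) h
  rwa [h1, h2] at this

theorem sq_add_four_le (a b c d : ℝ) :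
    (a + b + c + d) ^ 2 ≤ 4 * (a ^ 2 + b ^ 2 + c ^ 2 + d ^ 2) := by
  nlinarith [sq_nonneg (a - b), sq_nonneg (a - c), sq_nonneg (a - d), sq_nonneg (b - c),
    sq_nonneg (b - d), sq_nonneg (c - d)]

end Polygon

namespace IsEquilateralGrid

variable {n : ℕ} {f fd : ℝ → EuclideanSpace ℝ (Fin n)} {L₁ L₂ h : ℝ} {m : ℕ} {θ : ℤ → ℝ}
  {i j : ℤ}

theorem not_dvd_sub (hi : i ∈ Finset.Icc (1 : ℤ) m) (hj : j ∈ Finset.Icc (1 : ℤ) m)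
    (hij : i ≠ j) : ¬ (m : ℤ) ∣ j - i := by
  rw [Finset.mem_Icc] at hi hj
  intro hd
  have := Int.eq_zero_of_abs_lt_dvd hd (by rw [abs_lt]; omega)
  omega

theorem le_mul_chn (H : IsEquilateralGrid f L₁ L₂ h m θ) (hij : ¬ (m : ℤ) ∣ j - i) :
    h ≤ L₂ / L₁ * chn f θ i j := by
  rw [div_mul_eq_mul_div, le_div_iff₀' H.L₁_pos]
  exact H.mul_le_chn hij

theorem chn_pos (H : IsEquilateralGrid f L₁ L₂ h m θ) (hij : ¬ (m : ℤ) ∣ j - i) :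
    0 < chn f θ i j := by
  have := (mul_pos H.L₁_pos H.h_pos).trans_le (H.mul_le_chn hij)
  exact pos_of_mul_pos_right this H.L₂_pos.le

theorem chn_succ_left_le (H : IsEquilateralGrid f L₁ L₂ h m θ) (a b : ℤ) :
    |chn f θ (a + 1) b - chn f θ a b| ≤ h :=
  (chn_succ_left_sub f θ a b).trans_eq (H.norm_edge a)

theorem chn_succ_right_le (H : IsEquilateralGrid f L₁ L₂ h m θ) (a b : ℤ) :
    |chn f θ a (b + 1) - chn f θ a b| ≤ h :=
  (chn_succ_right_sub f θ a b).trans_eq (H.norm_edge b)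

theorem chn_le_mul_chn_succ (H : IsEquilateralGrid f L₁ L₂ h m θ) (hij : ¬ (m : ℤ) ∣ j - i) :
    chn f θ i j ≤ (1 + 2 * (L₂ / L₁)) * chn f θ (i + 1) (j + 1) := by
  have h1 := (abs_le.1 (H.chn_succ_left_le i j)).1
  have h2 := (abs_le.1 (H.chn_succ_right_le (i + 1) j)).1
  have h3 := H.le_mul_chn (i := i + 1) (j := j + 1) (by simpa using hij)
  linarith

theorem sq_edgeDeviation_le (H : IsEquilateralGrid f L₁ L₂ h m θ)
    (hfd : LocallyIntegrable fd volume) (hFTC : ∀ a b : ℝ, f b - f a = ∫ t in a..b, fd t)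
    (hker : IntegrableOn (hKernel fd) (Set.Ico (0 : ℝ) 2 ×ˢ Set.Ico (0 : ℝ) 2))
    (hi : i ∈ Finset.Icc (1 : ℤ) m) (hj : j ∈ Finset.Icc (1 : ℤ) m) (hij : i ≠ j) {η : ℝ}
    (hη : 1 ≤ η ∨ (1 + 4 * (L₂ / L₁)) * chn f θ i j / L₁ ≤ η) :
    edgeDeviation f θ i j ^ 2 ≤
      16 * (L₂ / L₁) * ((1 + 4 * (L₂ / L₁)) / L₁) ^ 2 *
        (chn f θ i j ^ 2 * blockEnergy fd θ η i j) := by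
  have hnd := not_dvd_sub hi hj hij
  have hh := H.le_mul_chn hnd
  have hL₁ := H.L₁_pos
  have hh0 := H.h_pos
  rw [Finset.mem_Icc] at hi hj
  set U := chn f θ i j with hU
  have key : ∀ a b, a ∈ Set.Icc (1 : ℤ) (m + 1) → b ∈ Set.Icc (1 : ℤ) (m + 1) →
      chn f θ a b ≤ U + 2 * h → ‖edge f θ b - edge f θ a‖ ^ 2 ≤
        4 * (L₂ / L₁) * ((1 + 4 * (L₂ / L₁)) * U / L₁) ^ 2 * cellEnergy fd θ η a b := by
    intro a b ha hb hab
    have hD : (chn f θ a b + 2 * h) / L₁ ≤ (1 + 4 * (L₂ / L₁)) * U / L₁ := by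
      gcongr; linarith
    refine H.sq_norm_edge_sub_edge_le hfd hFTC hker ha hb hD fun x hx y hy => ?_
    rcases hη with hη | hη
    · exact (circleDist_le_one x y).trans hη
    · refine le_trans ?_ (hD.trans hη)
      rw [le_div_iff₀' hL₁]
      exact H.mul_circleDist_le hx hy
  have u10 := (abs_le.1 (H.chn_succ_left_le i j)).2
  have u01 := (abs_le.1 (H.chn_succ_right_le i j)).2
  have u11 := (abs_le.1 (H.chn_succ_right_le (i + 1) j)).2
  have k00 := key i j ⟨by omega, by omega⟩ ⟨by omega, by omega⟩ (by linarith)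
  have k10 := key (i + 1) j ⟨by omega, by omega⟩ ⟨by omega, by omega⟩ (by linarith)
  have k01 := key i (j + 1) ⟨by omega, by omega⟩ ⟨by omega, by omega⟩ (by linarith)
  have k11 := key (i + 1) (j + 1) ⟨by omega, by omega⟩ ⟨by omega, by omega⟩ (by linarith)
  calc edgeDeviation f θ i j ^ 2 ≤ _ := sq_add_four_le _ _ _ _
    _ ≤ 4 * (4 * (L₂ / L₁) * ((1 + 4 * (L₂ / L₁)) * U / L₁) ^ 2 * blockEnergy fd θ η i j) := by
      gcongr
      refine (add_le_add (add_le_add (add_le_add k00 k10) k01) k11).trans_eq ?_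
      rw [blockEnergy]; ring
    _ = _ := by ring

theorem sq_norm_edge_succ_sub_le (H : IsEquilateralGrid f L₁ L₂ h m θ)
    (hfd : LocallyIntegrable fd volume) (hFTC : ∀ a b : ℝ, f b - f a = ∫ t in a..b, fd t)
    (hker : IntegrableOn (hKernel fd) (Set.Ico (0 : ℝ) 2 ×ˢ Set.Ico (0 : ℝ) 2))
    (hi : i ∈ Finset.Icc (1 : ℤ) m) :
    ‖edge f θ (i + 1) - edge f θ i‖ ^ 2 ≤
      36 * (L₂ / L₁) / L₁ ^ 2 * (h ^ 2 * cellEnergy fd θ 1 i (i + 1)) := by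
  rw [Finset.mem_Icc] at hi
  have h1 : chn f θ i (i + 1) = h := H.norm_edge i
  refine (H.sq_norm_edge_sub_edge_le hfd hFTC hker (a := i) (b := i + 1) ⟨by omega, by omega⟩
    ⟨by omega, by omega⟩ le_rfl fun x _ y _ => circleDist_le_one x y).trans_eq ?_
  rw [h1]
  ring

/-- The pointwise bound underlying the convergence of both remainder sums: a part controlled by
the energy near the diagonal and a part of lower order. -/
def HasRemainderBound (fd : ℝ → EuclideanSpace ℝ (Fin n)) (θ : ℤ → ℝ) (h : ℝ) (m : ℕ)
    (C η B : ℝ) (F : ℤ → ℤ → ℝ) : Prop :=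
  ∀ i ∈ Finset.Icc (1 : ℤ) m, ∀ j ∈ Finset.Icc (1 : ℤ) m, i ≠ j →
    |F i j| ≤ C * blockEnergy fd θ η i j + B * (h * blockEnergy fd θ 1 i j +
      h ^ 2 * (cellEnergy fd θ 1 i (i + 1) + cellEnergy fd θ 1 j (j + 1)))

theorem abs_shiftDiff_le_edgeDeviation (i j : ℤ) :
    |shiftDiff (chn f θ) i j| ≤ edgeDeviation f θ i j ∧
    |shiftDiff (chn f θ) (i + 1) j| ≤ edgeDeviation f θ i j ∧
    |shiftDiff (chn f θ) i (j + 1)| ≤ edgeDeviation f θ i j ∧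
    |shiftDiff (chn f θ) (i + 1) (j + 1)| ≤ edgeDeviation f θ i j := by
  have n1 := norm_nonneg (edge f θ j - edge f θ i)
  have n2 := norm_nonneg (edge f θ j - edge f θ (i + 1))
  have n3 := norm_nonneg (edge f θ (j + 1) - edge f θ i)
  have n4 := norm_nonneg (edge f θ (j + 1) - edge f θ (i + 1))
  unfold edgeDeviation
  refine ⟨(abs_shiftDiff_chn_le f θ _ _).trans ?_, (abs_shiftDiff_chn_le f θ _ _).trans ?_,
    (abs_shiftDiff_chn_le f θ _ _).trans ?_, (abs_shiftDiff_chn_le f θ _ _).trans ?_⟩ <;> linarith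

theorem hasRemainderBound_quotientTerm (H : IsEquilateralGrid f L₁ L₂ h m θ)
    (hfd : LocallyIntegrable fd volume) (hFTC : ∀ a b : ℝ, f b - f a = ∫ t in a..b, fd t)
    (hker : IntegrableOn (hKernel fd) (Set.Ico (0 : ℝ) 2 ×ˢ Set.Ico (0 : ℝ) 2)) {δ : ℝ}
    (hδ : 0 < δ) :
    let κ := L₂ / L₁
    let K := 8 * (1 + 2 * κ) ^ 2 * (1 + κ) * (16 * κ * ((1 + 4 * κ) / L₁) ^ 2)
    HasRemainderBound fd θ h m (K * κ) ((1 + 4 * κ) / L₁ * δ) (K / δ)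
      (quotientTerm (chn f θ)) := by
  intro κ K i hi j hj hij
  have hnd := not_dvd_sub hi hj hij
  have hU := H.chn_pos hnd
  have hV := H.chn_pos (i := i + 1) (j := j + 1) (by simpa using hnd)
  have hhU : h ≤ κ * chn f θ i j := H.le_mul_chn hnd
  have hL₁ := H.L₁_pos
  have hh0 := H.h_pos
  have hκ : 0 < κ := div_pos H.L₂_pos hL₁
  obtain ⟨d00, d10, d01, d11⟩ := abs_shiftDiff_le_edgeDeviation (f := f) (θ := θ) i j
  have hb := abs_quotientTerm_le (u := chn f θ) (fun a b => norm_nonneg _) H.chn_succ_left_le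
    H.chn_succ_right_le hU hV (by positivity) (H.chn_le_mul_chn_succ hnd) hhU d00 d10 d01 d11
  have hdev := fun η hη => H.sq_edgeDeviation_le hfd hFTC hker hi hj hij (η := η) hη
  have hE := cellEnergy_nonneg fd θ 1
  have hS := blockEnergy_nonneg fd θ
  set U := chn f θ i j with hUdef
  set s := edgeDeviation f θ i j
  have hdev' : ∀ η, (1 ≤ η ∨ (1 + 4 * κ) * U / L₁ ≤ η) →
      8 * (1 + 2 * κ) ^ 2 * (1 + κ) * (s ^ 2 / U ^ 2) ≤ K * blockEnergy fd θ η i j := by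
    intro η hη
    have h1 : s ^ 2 / U ^ 2 ≤
        16 * κ * ((1 + 4 * κ) / L₁) ^ 2 * blockEnergy fd θ η i j := by
      rw [div_le_iff₀ (by positivity)]
      refine (hdev η hη).trans_eq (by ring)
    calc _ ≤ 8 * (1 + 2 * κ) ^ 2 * (1 + κ) *
        (16 * κ * ((1 + 4 * κ) / L₁) ^ 2 * blockEnergy fd θ η i j) := by gcongr
      _ = _ := by ring
  have hK : 0 < K := by positivity
  rcases le_or_gt U δ with hUδ | hUδ
  · have h1 := hdev' ((1 + 4 * κ) / L₁ * δ) (Or.inr (by rw [mul_div_right_comm]; gcongr))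
    have h2 : h / U ≤ κ := (div_le_iff₀ hU).2 hhU
    have h3 : |quotientTerm (chn f θ) i j| ≤
        K * blockEnergy fd θ ((1 + 4 * κ) / L₁ * δ) i j * κ := by
      have := hS ((1 + 4 * κ) / L₁ * δ) i j
      exact hb.trans (mul_le_mul h1 h2 (by positivity) (by positivity))
    refine le_add_of_le_of_nonneg (h3.trans_eq (by ring)) ?_
    have := hS 1 i j
    have := hE i (i + 1)
    have := hE j (j + 1)
    positivity
  · have h1 := hdev' 1 (Or.inl le_rfl)
    have h2 : h / U ≤ h / δ := by gcongr
    have h3 : |quotientTerm (chn f θ) i j| ≤ K * blockEnergy fd θ 1 i j * (h / δ) := by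
      have := hS 1 i j
      exact hb.trans (mul_le_mul h1 h2 (by positivity) (by positivity))
    have := hS ((1 + 4 * κ) / L₁ * δ) i j
    have := hS 1 i j
    have := hE i (i + 1)
    have := hE j (j + 1)
    have h4 :
        0 ≤ K / δ * (h ^ 2 * (cellEnergy fd θ 1 i (i + 1) + cellEnergy fd θ 1 j (j + 1))) := by
      positivity
    have h5 : 0 ≤ K * κ * blockEnergy fd θ ((1 + 4 * κ) / L₁ * δ) i j := by positivity
    calc _ ≤ _ := h3
      _ = K / δ * (h * blockEnergy fd θ 1 i j) := by ring
      _ ≤ _ := by rw [mul_add]; linarith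

/-- Improved bounds for the differences of `u_{(i+1)(j+1)} - u_{ij}` along long chords. -/
theorem abs_diff_shiftDiff_le (H : IsEquilateralGrid f L₁ L₂ h m θ) (hU : 4 * h ≤ chn f θ i j) :
    |dOpI (aOpJ (shiftDiff (chn f θ))) i j| ≤ ‖edge f θ (i + 1) - edge f θ i‖ +
        8 * h * edgeDeviation f θ i j / chn f θ i j ∧
    |dOpJ (aOpI (shiftDiff (chn f θ))) i j| ≤ ‖edge f θ (j + 1) - edge f θ j‖ +
        8 * h * edgeDeviation f θ i j / chn f θ i j := by
  have hh := H.h_pos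
  have u10 := (abs_le.1 (H.chn_succ_left_le i j)).1
  have u01 := (abs_le.1 (H.chn_succ_right_le i j)).1
  have u11 := (abs_le.1 (H.chn_succ_right_le (i + 1) j)).1
  have n1 := norm_nonneg (edge f θ j - edge f θ i)
  have n2 := norm_nonneg (edge f θ j - edge f θ (i + 1))
  have n3 := norm_nonneg (edge f θ (j + 1) - edge f θ i)
  have n4 := norm_nonneg (edge f θ (j + 1) - edge f θ (i + 1))
  have hs : 0 ≤ edgeDeviation f θ i j := by unfold edgeDeviation; positivity
  set U := chn f θ i j
  have hfrac : ∀ {x y : ℝ}, x ≤ edgeDeviation f θ i j → U / 2 ≤ y →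
      4 * h * x / y ≤ 8 * h * edgeDeviation f θ i j / U := by
    intro x y hx hy
    have hU0 : 0 < U := by linarith
    calc 4 * h * x / y ≤ 4 * h * edgeDeviation f θ i j / (U / 2) := by gcongr
      _ = _ := by field_simp; ring
  constructor
  · refine abs_dOpI_aOpJ_le ?_ ?_
    · refine (abs_shiftDiff_succ_left_sub_le f θ (by linarith)).trans ?_
      rw [H.norm_edge]
      gcongr 1
      exact hfrac (by unfold edgeDeviation; linarith) (by linarith)
    · refine (abs_shiftDiff_succ_left_sub_le f θ (by linarith)).trans ?_
      rw [H.norm_edge]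
      gcongr 1
      exact hfrac (by unfold edgeDeviation; linarith) (by linarith)
  · refine abs_dOpJ_aOpI_le ?_ ?_
    · refine (abs_shiftDiff_succ_right_sub_le f θ (by linarith)).trans ?_
      rw [H.norm_edge]
      gcongr 1
      exact hfrac (by unfold edgeDeviation; linarith) (by linarith)
    · refine (abs_shiftDiff_succ_right_sub_le f θ (by linarith)).trans ?_
      rw [H.norm_edge]
      gcongr 1
      exact hfrac (by unfold edgeDeviation; linarith) (by linarith)

theorem hasRemainderBound_productTerm (H : IsEquilateralGrid f L₁ L₂ h m θ)
    (hfd : LocallyIntegrable fd volume) (hFTC : ∀ a b : ℝ, f b - f a = ∫ t in a..b, fd t)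
    (hker : IntegrableOn (hKernel fd) (Set.Ico (0 : ℝ) 2 ×ˢ Set.Ico (0 : ℝ) 2)) {δ : ℝ}
    (hδ : 0 < δ) (hhδ : 4 * h ≤ δ) (hh1 : h ≤ 1) :
    let κ := L₂ / L₁
    let K := 16 * κ * ((1 + 4 * κ) / L₁) ^ 2
    HasRemainderBound fd θ h m (2 * (1 + 2 * κ) * K) ((1 + 4 * κ) / L₁ * δ)
      ((1 + 2 * κ) / 2 * ((36 * κ / L₁ ^ 2 + 128 * K) / δ ^ 2)) (productTerm (chn f θ)) := by
  intro κ K i hi j hj hij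
  have hnd := not_dvd_sub hi hj hij
  have hU := H.chn_pos hnd
  have hV := H.chn_pos (i := i + 1) (j := j + 1) (by simpa using hnd)
  have hL₁ := H.L₁_pos
  have hh0 := H.h_pos
  have hκ : 0 < κ := div_pos H.L₂_pos hL₁
  obtain ⟨d00, d10, d01, d11⟩ := abs_shiftDiff_le_edgeDeviation (f := f) (θ := θ) i j
  have hdev := fun η hη => H.sq_edgeDeviation_le hfd hFTC hker hi hj hij (η := η) hη
  have hE := cellEnergy_nonneg fd θ 1
  have hS := blockEnergy_nonneg fd θ
  have hK : 0 < K := by positivity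
  have hUV := H.chn_le_mul_chn_succ hnd
  have hfar := fun h4 => H.abs_diff_shiftDiff_le (i := i) (j := j) h4
  have hTi := H.sq_norm_edge_succ_sub_le hfd hFTC hker hi
  have hTj := H.sq_norm_edge_succ_sub_le hfd hFTC hker hj
  set U := chn f θ i j with hUdef
  set s := edgeDeviation f θ i j
  have hdev' : ∀ η, (1 ≤ η ∨ (1 + 4 * κ) * U / L₁ ≤ η) →
      s ^ 2 / U ^ 2 ≤ K * blockEnergy fd θ η i j := by
    intro η hη
    rw [div_le_iff₀ (by positivity)]
    exact (hdev η hη).trans_eq (by ring)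
  have S1 := hS ((1 + 4 * κ) / L₁ * δ) i j
  have S2 := hS 1 i j
  have E1 := hE i (i + 1)
  have E2 := hE j (j + 1)
  rcases le_or_gt U δ with hUδ | hUδ
  · have h1 := hdev' ((1 + 4 * κ) / L₁ * δ) (Or.inr (by rw [mul_div_right_comm]; gcongr))
    have hb := abs_productTerm_le hU hV hUV
      (abs_dOpI_aOpJ_le (abs_sub_le_two_mul d10 d00) (abs_sub_le_two_mul d11 d01))
      (abs_dOpJ_aOpI_le (abs_sub_le_two_mul d01 d00) (abs_sub_le_two_mul d11 d10))
    refine le_add_of_le_of_nonneg ?_ (by positivity)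
    calc _ ≤ _ := hb
      _ = 2 * (1 + 2 * κ) * (s ^ 2 / U ^ 2) := by ring
      _ ≤ 2 * (1 + 2 * κ) * (K * blockEnergy fd θ ((1 + 4 * κ) / L₁ * δ) i j) := by gcongr
      _ = _ := by ring
  · have h1 := hdev' 1 (Or.inl le_rfl)
    have hf := hfar (hhδ.trans hUδ.le)
    have hb := abs_productTerm_le hU hV hUV hf.1 hf.2
    set T := ‖edge f θ (i + 1) - edge f θ i‖
    set T' := ‖edge f θ (j + 1) - edge f θ j‖
    set Ei := cellEnergy fd θ 1 i (i + 1)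
    set Ej := cellEnergy fd θ 1 j (j + 1)
    set S := blockEnergy fd θ 1 i j
    have hprod : (T + 8 * h * s / U) * (T' + 8 * h * s / U) ≤
        T ^ 2 + T' ^ 2 + 128 * h ^ 2 * (s ^ 2 / U ^ 2) := by
      have : 128 * h ^ 2 * (s ^ 2 / U ^ 2) = 2 * (8 * h * s / U) ^ 2 := by ring
      rw [this]
      nlinarith [sq_nonneg (T - T'), sq_nonneg (T - 8 * h * s / U), sq_nonneg (T' - 8 * h * s / U)]
    have hh2 : h ^ 2 ≤ h := by nlinarith
    have hnum : (T + 8 * h * s / U) * (T' + 8 * h * s / U) ≤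
        (36 * κ / L₁ ^ 2 + 128 * K) * (h * S + h ^ 2 * (Ei + Ej)) := by
      calc _ ≤ _ := hprod
        _ ≤ 36 * κ / L₁ ^ 2 * (h ^ 2 * Ei) + 36 * κ / L₁ ^ 2 * (h ^ 2 * Ej) +
            128 * h * (K * S) := by gcongr
        _ = 36 * κ / L₁ ^ 2 * (h ^ 2 * (Ei + Ej)) + 128 * K * (h * S) := by ring
        _ ≤ 36 * κ / L₁ ^ 2 * (h * S + h ^ 2 * (Ei + Ej)) +
            128 * K * (h * S + h ^ 2 * (Ei + Ej)) := by
          gcongr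
          · exact le_add_of_nonneg_left (by positivity)
          · exact le_add_of_nonneg_right (by positivity)
        _ = _ := by ring
    refine le_add_of_nonneg_of_le (by positivity) ?_
    calc _ ≤ _ := hb
      _ ≤ (1 + 2 * κ) / 2 * ((36 * κ / L₁ ^ 2 + 128 * K) * (h * S + h ^ 2 * (Ei + Ej)) /
          δ ^ 2) := by
        gcongr
      _ = _ := by ring

theorem abs_discSum_le (H : IsEquilateralGrid f L₁ L₂ h m θ)
    (hker : IntegrableOn (hKernel fd) (Set.Ico (0 : ℝ) 2 ×ˢ Set.Ico (0 : ℝ) 2))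
    {C η B : ℝ} (hC : 0 ≤ C) (hB : 0 ≤ B) {F : ℤ → ℤ → ℝ}
    (hF : HasRemainderBound fd θ h m C η B F) :
    |discSum m F| ≤ 4 * C * nearEnergy fd η + B * (4 + 2 * L₂) * nearEnergy fd 1 * h := by
  have hh := H.h_pos
  set s := Finset.Icc (1 : ℤ) (m : ℤ) with hs
  have hcard : (s.card : ℝ) = m := by simp [hs]
  have hblock : ∀ η', ∑ i ∈ s, ∑ j ∈ s, blockEnergy fd θ η' i j ≤ 4 * nearEnergy fd η' := by
    intro η'
    have hsum : ∀ a b : ℤ, (a = 0 ∨ a = 1) → (b = 0 ∨ b = 1) →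
        ∑ p ∈ s ×ˢ s, cellEnergy fd θ η' (p.1 + a) (p.2 + b) ≤ nearEnergy fd η' := by
      intro a b ha hb
      refine H.sum_cellEnergy_le hker η' (s ×ˢ s) (fun p => (p.1 + a, p.2 + b)) ?_ ?_
      · rintro ⟨x, y⟩ _ ⟨x', y'⟩ _ hxy
        simpa using hxy
      · rintro ⟨x, y⟩ hxy
        simp only [hs, Finset.mem_product, Finset.mem_Icc] at hxy
        simp only [Set.mem_prod, Set.mem_Icc]
        omega
    rw [← Finset.sum_product']
    simp only [blockEnergy, Finset.sum_add_distrib]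
    have h00 := hsum 0 0 (by simp) (by simp)
    have h10 := hsum 1 0 (by simp) (by simp)
    have h01 := hsum 0 1 (by simp) (by simp)
    have h11 := hsum 1 1 (by simp) (by simp)
    simp only [add_zero] at h00 h10 h01
    linarith
  have hdiag : ∑ i ∈ s, cellEnergy fd θ 1 i (i + 1) ≤ nearEnergy fd 1 := by
    refine H.sum_cellEnergy_le hker 1 s (fun i => (i, i + 1)) ?_ ?_
    · intro x _ y _ hxy
      simpa using hxy
    · intro x hx
      simp only [hs, Finset.mem_Icc] at hx
      simp only [Set.mem_prod, Set.mem_Icc]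
      omega
  have hterm : |discSum m F| ≤ ∑ i ∈ s, ∑ j ∈ s, (C * blockEnergy fd θ η i j +
      B * (h * blockEnergy fd θ 1 i j +
        h ^ 2 * (cellEnergy fd θ 1 i (i + 1) + cellEnergy fd θ 1 j (j + 1)))) := by
    refine (Finset.abs_sum_le_sum_abs _ _).trans (Finset.sum_le_sum fun i hi => ?_)
    refine (Finset.abs_sum_le_sum_abs _ _).trans (Finset.sum_le_sum fun j hj => ?_)
    split_ifs with hij
    · have := blockEnergy_nonneg fd θ η i j
      have := blockEnergy_nonneg fd θ 1 i j
      have := cellEnergy_nonneg fd θ 1 i (i + 1)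
      have := cellEnergy_nonneg fd θ 1 j (j + 1)
      rw [abs_zero]
      positivity
    · exact hF i hi j hj hij
  have hE := nearEnergy_nonneg fd 1
  refine hterm.trans ?_
  simp only [mul_add, Finset.sum_add_distrib, ← Finset.mul_sum, Finset.sum_const, nsmul_eq_mul,
    hcard]
  have e1 := mul_le_mul_of_nonneg_left (hblock η) hC
  have e2 := mul_le_mul_of_nonneg_left (hblock 1) (mul_nonneg hB hh.le)
  have e3 : m * h * (B * h * ∑ i ∈ s, cellEnergy fd θ 1 i (i + 1)) ≤
      L₂ * (B * h * nearEnergy fd 1) := by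
    have := H.card_mul_le
    have := H.L₂_pos
    gcongr
    exact mul_nonneg (by positivity) (Finset.sum_nonneg fun i _ => cellEnergy_nonneg fd θ 1 _ _)
  linarith

end IsEquilateralGrid

/-- A sequence vanishes in the limit if it is bounded by `C Φ(cδ) + B(δ) h_m` for every `δ > 0`,
where `Φ(0⁺) = 0` and `h_m → 0`. -/
theorem tendsto_zero_of_eventually_abs_le {Φ : ℝ → ℝ} {a h : ℕ → ℝ} {C c : ℝ} {B : ℝ → ℝ}
    (hΦ : Filter.Tendsto Φ (nhdsWithin 0 (Set.Ioi 0)) (nhds 0))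
    (hh : Filter.Tendsto h Filter.atTop (nhds 0)) (hc : 0 < c)
    (ha : ∀ δ > 0, ∀ᶠ m in Filter.atTop, |a m| ≤ C * Φ (c * δ) + B δ * h m) :
    Filter.Tendsto a Filter.atTop (nhds 0) := by
  have hcδ : Filter.Tendsto (fun δ : ℝ => c * δ) (nhdsWithin 0 (Set.Ioi 0))
      (nhdsWithin 0 (Set.Ioi 0)) := by
    refine tendsto_nhdsWithin_iff.2 ⟨?_, ?_⟩
    · have : Filter.Tendsto (fun δ : ℝ => c * δ) (nhds 0) (nhds (c * 0)) :=
        (continuous_const.mul continuous_id).tendsto 0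
      rw [mul_zero] at this
      exact this.mono_left nhdsWithin_le_nhds
    · filter_upwards [self_mem_nhdsWithin] with δ hδ using mul_pos hc hδ
  have h1 : Filter.Tendsto (fun δ => C * Φ (c * δ)) (nhdsWithin 0 (Set.Ioi 0)) (nhds 0) := by
    simpa using (hΦ.comp hcδ).const_mul C
  rw [Metric.tendsto_nhds]
  intro ε hε
  obtain ⟨δ, hδε, hδ⟩ := ((h1.eventually (gt_mem_nhds (half_pos hε))).and
    self_mem_nhdsWithin).exists
  have h2 : Filter.Tendsto (fun m => B δ * h m) Filter.atTop (nhds 0) := by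
    simpa using hh.const_mul (B δ)
  filter_upwards [ha δ hδ, h2.eventually (gt_mem_nhds (half_pos hε))] with m hm1 hm2
  rw [Real.dist_eq, sub_zero]
  linarith

/-- The remainder terms `I₂₁` and `I₂₂` of the discrete energy density sum to
zero in the limit `m → ∞`. -/
theorem remainder_I21_I22_tendsto_zero (n : ℕ)
    (f fd : ℝ → EuclideanSpace ℝ (Fin n))
    (hf_per : ∀ x : ℝ, f (x + 1) = f x)
    (hfd_per : ∀ x : ℝ, fd (x + 1) = fd x)
    (hfd_loc : LocallyIntegrable fd volume)
    (hFTC : ∀ a b : ℝ, f b - f a = ∫ t in a..b, fd t)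
    (hH12 : IntegrableOn
      (fun p : ℝ × ℝ => ‖fd p.1 - fd p.2‖ ^ 2 / circleDist p.1 p.2 ^ 2)
      (Set.Ico (0 : ℝ) 1 ×ˢ Set.Ico (0 : ℝ) 1) volume)
    (hT12 : IntegrableOn
      (fun p : ℝ × ℝ =>
        ‖(‖fd p.1‖⁻¹ • fd p.1) - (‖fd p.2‖⁻¹ • fd p.2)‖ ^ 2 / circleDist p.1 p.2 ^ 2)
      (Set.Ico (0 : ℝ) 1 ×ˢ Set.Ico (0 : ℝ) 1) volume)
    (L₁ L₂ : ℝ) (hL₁ : 0 < L₁) (hL₁₂ : L₁ ≤ L₂)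
    (hbl : ∀ a b : ℝ,
      L₁ * circleDist a b ≤ ‖f a - f b‖ ∧ ‖f a - f b‖ ≤ L₂ * circleDist a b)
    (L : ℝ) (hL : L = ∫ t in (0:ℝ)..1, ‖fd t‖)
    (θ : ℕ → ℤ → ℝ)
    (hmono : ∀ m : ℕ, 1 ≤ m → StrictMono (θ m))
    (hθper : ∀ m : ℕ, 1 ≤ m → ∀ i : ℤ, θ m (i + m) = θ m i + 1)
    (hθ0 : ∀ m : ℕ, 1 ≤ m → 0 ≤ θ m 1)
    (hθ1 : ∀ m : ℕ, 1 ≤ m → θ m (m : ℤ) < 1)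
    (Lm : ℕ → ℝ)
    (hLm : ∀ m : ℕ, Lm m = ∑ i ∈ Finset.Icc (1 : ℤ) (m : ℤ), ‖edge f (θ m) i‖)
    (heq : ∀ m : ℕ, 1 ≤ m → ∀ i : ℤ, ‖edge f (θ m) i‖ = Lm m / m)
    (hK : Filter.Tendsto (fun ε : ℝ => ε⁻¹ * Kmod fd ε ^ 2)
      (nhdsWithin 0 (Set.Ioi 0)) (nhds 0))
 :
    Filter.Tendsto
      (fun m : ℕ => discSum m (fun i j =>
        -(1 / 2) *
          (aOpIJ (fun a b => chn f (θ m) (a + 1) (b + 1) - chn f (θ m) a b) i j /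
            (chn f (θ m) i j * chn f (θ m) (i + 1) (j + 1))) *
          ((dOpI (aOpJ (chn f (θ m))) i j * dOpJ (aOpI (chn f (θ m))) i j) /
              aOpIJ (chn f (θ m)) i j -
            (dOpI (aOpJ (fun a b => chn f (θ m) (a + 1) (b + 1))) i j *
                dOpJ (aOpI (fun a b => chn f (θ m) (a + 1) (b + 1))) i j) /
              aOpIJ (fun a b => chn f (θ m) (a + 1) (b + 1)) i j)))
      Filter.atTop (nhds 0) ∧
    Filter.Tendsto
      (fun m : ℕ => discSum m (fun i j =>
        -(1 / (2 * (chn f (θ m) i j * chn f (θ m) (i + 1) (j + 1)))) *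
          dOpI (aOpJ (fun a b => chn f (θ m) (a + 1) (b + 1) - chn f (θ m) a b)) i j *
          dOpJ (aOpI (fun a b => chn f (θ m) (a + 1) (b + 1) - chn f (θ m) a b)) i j))
      Filter.atTop (nhds 0) := by
  have hL₂ : 0 < L₂ := hL₁.trans_le hL₁₂
  have hker := integrableOn_hKernel_Ico_two hfd_per hH12
  have hΦ := nearEnergy_tendsto_zero hker
  have hlarge : ∀ᶠ m : ℕ in Filter.atTop, 1 + L₂ / L₁ < m :=
    tendsto_natCast_atTop_atTop.eventually_gt_atTop _
  have hgrid : ∀ᶠ m : ℕ in Filter.atTop, IsEquilateralGrid f L₁ L₂ (Lm m / m) m (θ m) := by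
    filter_upwards [hlarge, Filter.eventually_ge_atTop 1] with m hm hm1
    exact isEquilateralGrid_of_lt hf_per hL₁ hL₂ (fun a b => (hbl a b).1) (fun a b => (hbl a b).2)
      (hmono m hm1) (hθper m hm1) (hθ0 m hm1) (hθ1 m hm1) (heq m hm1) hm
  have hh : Filter.Tendsto (fun m : ℕ => Lm m / m) Filter.atTop (nhds 0) := by
    refine tendsto_of_tendsto_of_tendsto_of_le_of_le' tendsto_const_nhds
      (tendsto_const_div_atTop_nhds_zero_nat L₂) ?_ ?_
    · filter_upwards [hgrid] with m H using H.h_pos.le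
    · filter_upwards [hgrid, Filter.eventually_ge_atTop 1] with m H hm
      rw [le_div_iff₀ (by exact_mod_cast hm), mul_comm]
      exact H.card_mul_le
  set κ := L₂ / L₁
  have hκ : 0 < κ := div_pos hL₂ hL₁
  have hc : 0 < (1 + 4 * κ) / L₁ := by positivity
  constructor
  · set K := 8 * (1 + 2 * κ) ^ 2 * (1 + κ) * (16 * κ * ((1 + 4 * κ) / L₁) ^ 2)
    have hK0 : 0 < K := by positivity
    change Filter.Tendsto (fun m : ℕ => discSum m (quotientTerm (chn f (θ m)))) _ _
    refine tendsto_zero_of_eventually_abs_le (C := 4 * (K * κ))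
      (B := fun δ => K / δ * (4 + 2 * L₂) * nearEnergy fd 1) hΦ hh hc fun δ hδ => ?_
    filter_upwards [hgrid] with m H
    exact H.abs_discSum_le hker (by positivity) (by positivity)
      (H.hasRemainderBound_quotientTerm hfd_loc hFTC hker hδ)
  · set K := 16 * κ * ((1 + 4 * κ) / L₁) ^ 2
    have hK0 : 0 < K := by positivity
    change Filter.Tendsto (fun m : ℕ => discSum m (productTerm (chn f (θ m)))) _ _
    refine tendsto_zero_of_eventually_abs_le (C := 4 * (2 * (1 + 2 * κ) * K))
      (B := fun δ => (1 + 2 * κ) / 2 * ((36 * κ / L₁ ^ 2 + 128 * K) / δ ^ 2) * (4 + 2 * L₂) *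
        nearEnergy fd 1) hΦ hh hc fun δ hδ => ?_
    filter_upwards [hgrid, hh.eventually (gt_mem_nhds (show 0 < δ / 4 by positivity)),
      hh.eventually (gt_mem_nhds one_pos)] with m H hm hm1
    exact H.abs_discSum_le hker (by positivity) (by positivity)
      (H.hasRemainderBound_productTerm hfd_loc hFTC hker hδ (by linarith) hm1.le)

end
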